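/- arXiv:2203.04023 — 2 statements merged into one kernel-verified Lean document; each statement's English description precedes it below -/
import Mathlib

section
/- In X = c₀, the set of norm attaining functionals equals ℓ₁ ∩ c₀₀ (the finitely supported elements of ℓ₁ = c₀*), and hence NA(c₀, 𝕂) is not residual in ℓ₁; moreover NA(c₀,𝕂) − NA(c₀,𝕂) = ℓ₁ ∩ c₀₀ ≠ ℓ₁. -/
open Filter Topology ZeroAtInfty

/-- The set of norm attaining functionals on `c₀ = C₀(ℕ, ℝ)`. -/
def NAc₀ : Set (C₀(ℕ, ℝ) →L[ℝ] ℝ) :=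
  {g | ∃ x : C₀(ℕ, ℝ), ‖x‖ = 1 ∧ |g x| = ‖g‖}

namespace CZero

theorem abs_apply_le_norm (x : C₀(ℕ, ℝ)) (n : ℕ) : |x n| ≤ ‖x‖ := by
  rw [← ZeroAtInftyContinuousMap.norm_toBCF_eq_norm]
  exact x.toBCF.norm_coe_le_norm n

theorem norm_le_of_abs_apply_le (x : C₀(ℕ, ℝ)) {C : ℝ} (hC : 0 ≤ C) (h : ∀ n, |x n| ≤ C) :
    ‖x‖ ≤ C := by
  rw [← ZeroAtInftyContinuousMap.norm_toBCF_eq_norm]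
  exact (BoundedContinuousFunction.norm_le hC).2 h

theorem tendsto_cofinite_zero (x : C₀(ℕ, ℝ)) : Tendsto x cofinite (𝓝 0) := by
  rw [← Filter.cocompact_eq_cofinite]
  exact x.zero_at_infty'

/-- The standard unit vectors of `c₀`. -/
def unitVec (n : ℕ) : C₀(ℕ, ℝ) where
  toFun := Pi.single n 1
  continuous_toFun := continuous_of_discreteTopology
  zero_at_infty' := by
    rw [Filter.cocompact_eq_cofinite]
    refine tendsto_const_nhds.congr' ?_
    filter_upwards [(Set.finite_singleton n).compl_mem_cofinite] with m hm
    exact (Pi.single_eq_of_ne (M := fun _ : ℕ => ℝ) hm 1).symm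

theorem unitVec_apply (n m : ℕ) : unitVec n m = if m = n then 1 else 0 :=
  Pi.single_apply n (1 : ℝ) m

theorem sum_smul_unitVec_apply (s : Finset ℕ) (c : ℕ → ℝ) (m : ℕ) :
    (∑ n ∈ s, c n • unitVec n) m = if m ∈ s then c m else 0 := by
  induction s using Finset.induction_on with
  | empty => simp
  | insert k s hk ih =>
    rw [Finset.sum_insert hk, ZeroAtInftyContinuousMap.add_apply, ih,
      ZeroAtInftyContinuousMap.smul_apply, unitVec_apply]
    by_cases h : m = k
    · subst h; simp [hk]
    · simp [h]

theorem hasSum_smul_unitVec (x : C₀(ℕ, ℝ)) : HasSum (fun n => x n • unitVec n) x := by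
  rw [HasSum, SummationFilter.unconditional_filter, Metric.tendsto_nhds]
  intro ε hε
  have hfin : {n | ¬ |x n| < ε / 2}.Finite := by
    have h := (Metric.tendsto_nhds.1 (tendsto_cofinite_zero x)) (ε / 2) (half_pos hε)
    simpa [Filter.eventually_cofinite] using h
  filter_upwards [eventually_ge_atTop hfin.toFinset] with s hs
  rw [dist_eq_norm]
  refine lt_of_le_of_lt (norm_le_of_abs_apply_le _ (half_pos hε).le fun m => ?_) (half_lt_self hε)
  rw [ZeroAtInftyContinuousMap.sub_apply, sum_smul_unitVec_apply]
  by_cases hm : m ∈ s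
  · simp [hm, (half_pos hε).le]
  · have : |x m| < ε / 2 := by
      by_contra h
      exact hm (hs (hfin.mem_toFinset.2 h))
    simpa [hm] using this.le

theorem apply_eq_sum (g : C₀(ℕ, ℝ) →L[ℝ] ℝ) (s : Finset ℕ) (hs : ∀ n ∉ s, g (unitVec n) = 0)
    (x : C₀(ℕ, ℝ)) : g x = ∑ n ∈ s, g (unitVec n) * x n := by
  have h := g.hasSum (hasSum_smul_unitVec x)
  refine h.unique ?_
  have h' : HasSum (fun n => g (unitVec n) * x n) (∑ n ∈ s, g (unitVec n) * x n) :=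
    hasSum_sum_of_ne_finset_zero fun n hn => by rw [hs n hn, zero_mul]
  convert h' using 2 with n
  simp [mul_comm]

theorem exists_finsupp_iff (g : C₀(ℕ, ℝ) →L[ℝ] ℝ) :
    (∃ a : ℕ →₀ ℝ, ∀ x : C₀(ℕ, ℝ), g x = ∑ n ∈ a.support, a n * x n) ↔
      {n | g (unitVec n) ≠ 0}.Finite := by
  constructor
  · rintro ⟨a, ha⟩
    refine a.support.finite_toSet.subset fun n hn => ?_
    by_contra h
    refine hn ?_
    rw [ha]
    refine Finset.sum_eq_zero fun m hm => ?_
    have : m ≠ n := fun e => h (e ▸ hm)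
    simp [unitVec_apply, this]
  · intro hfin
    refine ⟨Finsupp.ofSupportFinite (fun n => g (unitVec n)) hfin, fun x => ?_⟩
    refine apply_eq_sum g _ (fun n hn => ?_) x
    exact Finsupp.notMem_support_iff.1 hn

theorem finite_of_mem_NAc₀ {g : C₀(ℕ, ℝ) →L[ℝ] ℝ} (hg : g ∈ NAc₀) :
    {n | g (unitVec n) ≠ 0}.Finite := by
  obtain ⟨x, hx, hgx⟩ := hg
  have h := (Metric.tendsto_nhds.1 (tendsto_cofinite_zero x)) (1 / 2) (by norm_num)
  refine (Filter.eventually_cofinite.1 h).subset fun n hn hlt => hn ?_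
  have hlt' : |x n| < 1 / 2 := by simpa using hlt
  have key : ∀ c : ℝ, |c| ≤ 1 / 2 → |g x + c * g (unitVec n)| ≤ |g x| := by
    intro c hc
    have hnorm : ‖x + c • unitVec n‖ ≤ 1 := by
      refine norm_le_of_abs_apply_le _ zero_le_one fun m => ?_
      rw [ZeroAtInftyContinuousMap.add_apply, ZeroAtInftyContinuousMap.smul_apply, unitVec_apply]
      by_cases hm : m = n
      · subst hm
        have := abs_add_le (x m) c
        simp only [if_true, smul_eq_mul, mul_one]
        linarith
      · simpa [hm] using (abs_apply_le_norm x m).trans hx.le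
    have := g.le_opNorm_of_le hnorm
    rw [hgx]
    simpa using this
  have h₁ := sq_le_sq.2 (key (1 / 2) (by norm_num))
  have h₂ := sq_le_sq.2 (key (-(1 / 2)) (by norm_num))
  exact pow_eq_zero_iff (two_ne_zero) |>.1 (le_antisymm (by linarith) (sq_nonneg _))

theorem mem_NAc₀_of_finite {g : C₀(ℕ, ℝ) →L[ℝ] ℝ} (hg : {n | g (unitVec n) ≠ 0}.Finite) :
    g ∈ NAc₀ := by
  -- inserting `0` keeps the test vector of norm one when `g = 0`
  set s : Finset ℕ := insert 0 hg.toFinset with hs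
  have hrep := apply_eq_sum g s fun n hn => by
    by_contra h
    exact hn (Finset.mem_insert_of_mem (hg.mem_toFinset.2 h))
  set c : ℕ → ℝ := fun n => if 0 ≤ g (unitVec n) then 1 else -1 with hc
  have hcabs : ∀ n, |c n| = 1 := fun n => by
    simp only [hc]; split_ifs <;> simp
  have hcmul : ∀ n, g (unitVec n) * c n = |g (unitVec n)| := fun n => by
    simp only [hc]
    split_ifs with h
    · rw [abs_of_nonneg h, mul_one]
    · rw [abs_of_neg (not_le.1 h), mul_neg_one]
  set x : C₀(ℕ, ℝ) := ∑ n ∈ s, c n • unitVec n with hx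
  have hxapp : ∀ n ∈ s, x n = c n := fun n hn => by
    rw [hx, sum_smul_unitVec_apply, if_pos hn]
  have hxnorm : ‖x‖ = 1 := by
    refine le_antisymm (norm_le_of_abs_apply_le _ zero_le_one fun m => ?_) ?_
    · rw [hx, sum_smul_unitVec_apply]
      split_ifs
      · exact (hcabs m).le
      · simp
    · have := abs_apply_le_norm x 0
      rwa [hxapp 0 (Finset.mem_insert_self _ _), hcabs] at this
  have hgx : g x = ∑ n ∈ s, |g (unitVec n)| := by
    rw [hrep]
    exact Finset.sum_congr rfl fun n hn => by rw [hxapp n hn, hcmul]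
  refine ⟨x, hxnorm, le_antisymm ?_ ?_⟩
  · simpa [hxnorm] using g.le_opNorm x
  · refine g.opNorm_le_bound (abs_nonneg _) fun y => ?_
    rw [hgx, abs_of_nonneg (Finset.sum_nonneg fun n _ => abs_nonneg _), hrep y, Finset.sum_mul]
    refine (Finset.abs_sum_le_sum_abs _ _).trans (Finset.sum_le_sum fun n _ => ?_)
    rw [abs_mul]
    exact mul_le_mul_of_nonneg_left (abs_apply_le_norm y n) (abs_nonneg _)

theorem mem_NAc₀_iff (g : C₀(ℕ, ℝ) →L[ℝ] ℝ) : g ∈ NAc₀ ↔ {n | g (unitVec n) ≠ 0}.Finite :=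
  ⟨finite_of_mem_NAc₀, mem_NAc₀_of_finite⟩

theorem sub_mem_NAc₀ {h k : C₀(ℕ, ℝ) →L[ℝ] ℝ} (hh : h ∈ NAc₀) (hk : k ∈ NAc₀) :
    h - k ∈ NAc₀ := by
  rw [mem_NAc₀_iff] at *
  refine (hh.union hk).subset fun n hn => ?_
  by_contra hcon
  simp only [Set.mem_union, Set.mem_ofPred_eq, not_or, not_not] at hcon
  exact hn (by simp [hcon.1, hcon.2])

theorem zero_mem_NAc₀ : (0 : C₀(ℕ, ℝ) →L[ℝ] ℝ) ∈ NAc₀ := by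
  simp [mem_NAc₀_iff]

/-- The coordinate functionals of `c₀`. -/
noncomputable def coord (n : ℕ) : C₀(ℕ, ℝ) →L[ℝ] ℝ :=
  LinearMap.mkContinuous
    { toFun := fun x => x n
      map_add' := fun _ _ => rfl
      map_smul' := fun _ _ => rfl } 1 fun x => by
        simpa using abs_apply_le_norm x n

theorem coord_apply (n : ℕ) (x : C₀(ℕ, ℝ)) : coord n x = x n := rfl

/-- The functionals on `c₀` whose coordinates vanish from index `N` on. -/
def vanishingFrom (N : ℕ) : Submodule ℝ (C₀(ℕ, ℝ) →L[ℝ] ℝ) where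
  carrier := {g | ∀ n, N ≤ n → g (unitVec n) = 0}
  add_mem' := fun {f g} hf hg n hn => by
    rw [add_apply, hf n hn, hg n hn, add_zero]
  zero_mem' := fun _ _ => rfl
  smul_mem' := fun c g hg n hn => by
    rw [smul_apply, hg n hn, smul_zero]

theorem mem_vanishingFrom {N : ℕ} {g : C₀(ℕ, ℝ) →L[ℝ] ℝ} :
    g ∈ vanishingFrom N ↔ ∀ n, N ≤ n → g (unitVec n) = 0 := Iff.rfl

theorem isClosed_vanishingFrom (N : ℕ) :
    IsClosed (vanishingFrom N : Set (C₀(ℕ, ℝ) →L[ℝ] ℝ)) := by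
  have : (vanishingFrom N : Set (C₀(ℕ, ℝ) →L[ℝ] ℝ)) =
      ⋂ (n) (_ : N ≤ n), {g | g (unitVec n) = 0} := by
    ext g
    simp [mem_vanishingFrom]
  rw [this]
  exact isClosed_biInter fun n _ => isClosed_eq (by fun_prop) continuous_const

theorem dense_compl_of_ne_top {E : Type*} [NormedAddCommGroup E] [NormedSpace ℝ E]
    (p : Submodule ℝ (E →L[ℝ] ℝ)) (hp : p ≠ ⊤) : Dense (p : Set (E →L[ℝ] ℝ))ᶜ := by
  rw [← interior_eq_empty_iff_dense_compl]
  by_contra h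
  exact hp (p.eq_top_of_nonempty_interior' (Set.nonempty_iff_ne_empty.2 h))

theorem baireSpace_dual (E : Type*) [NormedAddCommGroup E] [NormedSpace ℝ E] :
    BaireSpace (E →L[ℝ] ℝ) := inferInstance

theorem dense_compl_vanishingFrom (N : ℕ) :
    Dense (vanishingFrom N : Set (C₀(ℕ, ℝ) →L[ℝ] ℝ))ᶜ := by
  refine dense_compl_of_ne_top (vanishingFrom N) fun htop => ?_
  have hmem : coord N ∈ vanishingFrom N := htop ▸ Submodule.mem_top
  have := hmem N le_rfl
  simp [coord_apply, unitVec_apply] at this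

theorem exists_mem_vanishingFrom {g : C₀(ℕ, ℝ) →L[ℝ] ℝ} (hg : g ∈ NAc₀) :
    ∃ N, g ∈ vanishingFrom N := by
  obtain ⟨B, hB⟩ := (finite_of_mem_NAc₀ hg).bddAbove
  refine ⟨B + 1, fun n hn => ?_⟩
  by_contra h
  have := hB h
  omega

theorem not_exists_isGδ_dense_subset_NAc₀ :
    ¬ ∃ G : Set (C₀(ℕ, ℝ) →L[ℝ] ℝ), G ⊆ NAc₀ ∧ IsGδ G ∧ Dense G := by
  rintro ⟨G, hsub, hGδ, hdense⟩
  have := baireSpace_dual C₀(ℕ, ℝ)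
  have hopen (N : ℕ) : IsOpen (vanishingFrom N : Set (C₀(ℕ, ℝ) →L[ℝ] ℝ))ᶜ :=
    (isClosed_vanishingFrom N).isOpen_compl
  have hD := dense_iInter_of_isOpen hopen dense_compl_vanishingFrom
  obtain ⟨g, hgG, hg⟩ :=
    (hdense.inter_of_Gδ hGδ (IsGδ.iInter_of_isOpen hopen) hD).nonempty
  obtain ⟨N, hN⟩ := exists_mem_vanishingFrom (hsub hgG)
  exact Set.mem_iInter.1 hg N hN

end CZero

theorem stmt8 :
    (NAc₀ = {g : C₀(ℕ, ℝ) →L[ℝ] ℝ |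
        ∃ a : ℕ →₀ ℝ, ∀ x : C₀(ℕ, ℝ), g x = ∑ n ∈ a.support, a n * x n}) ∧
    (¬ ∃ G : Set (C₀(ℕ, ℝ) →L[ℝ] ℝ), G ⊆ NAc₀ ∧ IsGδ G ∧ Dense G) ∧
    ({g : C₀(ℕ, ℝ) →L[ℝ] ℝ | ∃ h ∈ NAc₀, ∃ k ∈ NAc₀, g = h - k} = NAc₀) ∧
    NAc₀ ≠ Set.univ := by
  refine ⟨?_, CZero.not_exists_isGδ_dense_subset_NAc₀, ?_, fun h => ?_⟩
  · ext g
    exact (CZero.mem_NAc₀_iff g).trans (CZero.exists_finsupp_iff g).symm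
  · ext g
    constructor
    · rintro ⟨h, hh, k, hk, rfl⟩
      exact CZero.sub_mem_NAc₀ hh hk
    · exact fun hg => ⟨g, hg, 0, CZero.zero_mem_NAc₀, (sub_zero g).symm⟩
  · exact CZero.not_exists_isGδ_dense_subset_NAc₀
      ⟨Set.univ, h.ge, IsGδ.univ, dense_univ⟩
end

section
/- Let X and Y be Banach spaces such that the set SE(X) of strongly exposing functionals on X is dense in X*, and suppose Y admits a countable James boundary {yₙ* : n ∈ ℕ} ⊆ S_{Y*}. Then the set of absolutely strongly exposing compact operators ASE(X,Y) ∩ K(X,Y) is dense in the space K(X,Y) of compact operators. -/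
open Filter Topology RCLike Bornology

/-- `f` strongly exposes the bounded set `C` at `x₀`. -/
def StronglyExposes {𝕜 X : Type} [RCLike 𝕜] [NormedAddCommGroup X] [NormedSpace 𝕜 X]
    (f : X →L[𝕜] 𝕜) (C : Set X) (x₀ : X) : Prop :=
  x₀ ∈ C ∧ (∀ x ∈ C, re (f x) ≤ re (f x₀)) ∧
    ∀ u : ℕ → X, (∀ n, u n ∈ C) →
      Tendsto (fun n => re (f (u n))) atTop (𝓝 (re (f x₀))) →
      Tendsto u atTop (𝓝 x₀)

/-- `f` strongly exposes the closed unit ball at `x₀`. -/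
def StronglyExposesBall {𝕜 X : Type} [RCLike 𝕜] [NormedAddCommGroup X] [NormedSpace 𝕜 X]
    (f : X →L[𝕜] 𝕜) (x₀ : X) : Prop :=
  ‖x₀‖ ≤ 1 ∧ re (f x₀) = ‖f‖ ∧
    ∀ u : ℕ → X, (∀ n, ‖u n‖ ≤ 1) →
      Tendsto (fun n => re (f (u n))) atTop (𝓝 ‖f‖) →
      Tendsto u atTop (𝓝 x₀)

/-- `T` absolutely strongly exposes the closed unit ball at `x₀`. -/
def AbsStronglyExposes {𝕜 X Y : Type} [RCLike 𝕜] [NormedAddCommGroup X] [NormedSpace 𝕜 X]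
    [NormedAddCommGroup Y] [NormedSpace 𝕜 Y] (T : X →L[𝕜] Y) (x₀ : X) : Prop :=
  ‖x₀‖ ≤ 1 ∧
    ∀ u : ℕ → X, (∀ n, ‖u n‖ ≤ 1) →
      Tendsto (fun n => ‖T (u n)‖) atTop (𝓝 ‖T‖) →
      ∃ θ : ℕ → 𝕜, (∀ n, ‖θ n‖ = 1) ∧ Tendsto (fun n => θ n • u n) atTop (𝓝 x₀)

/-- The functionals having a slice of the closed unit ball contained in a ball of radius `r`. -/
def smallSliceFunctionals (𝕜 X : Type) [RCLike 𝕜] [NormedAddCommGroup X] [NormedSpace 𝕜 X]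
    (r : ℝ) : Set (X →L[𝕜] 𝕜) :=
  {f | ∃ δ : ℝ, 0 < δ ∧ ∃ z : X, ∀ x : X, ‖x‖ ≤ 1 → ‖f‖ - δ < re (f x) → ‖x - z‖ < r}

section Functionals

variable {𝕜 X : Type} [RCLike 𝕜] [NormedAddCommGroup X] [NormedSpace 𝕜 X]

lemma isOpen_smallSliceFunctionals (r : ℝ) : IsOpen (smallSliceFunctionals 𝕜 X r) := by
  rw [Metric.isOpen_iff]
  rintro f ⟨δ, hδ, z, hz⟩
  refine ⟨δ / 3, by positivity, fun g hg => ⟨δ / 3, by positivity, z, fun x hx hgx => hz x hx ?_⟩⟩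
  rw [Metric.mem_ball, dist_eq_norm] at hg
  have hre : re (g x) - re (f x) ≤ ‖g - f‖ := by
    calc re (g x) - re (f x) = re ((g - f) x) := by simp
      _ ≤ ‖(g - f) x‖ := re_le_norm _
      _ ≤ ‖g - f‖ := (g - f).unit_le_opNorm x hx
  have hnorm : ‖f‖ - ‖g‖ ≤ ‖g - f‖ := by
    rw [norm_sub_rev]; exact norm_sub_norm_le f g
  linarith

lemma StronglyExposesBall.mem_smallSliceFunctionals {f : X →L[𝕜] 𝕜} {x₀ : X}
    (h : StronglyExposesBall f x₀) {r : ℝ} (hr : 0 < r) : f ∈ smallSliceFunctionals 𝕜 X r := by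
  by_contra hf
  have hbad : ∀ n : ℕ, ∃ x : X, ‖x‖ ≤ 1 ∧ ‖f‖ - 1 / ((n : ℝ) + 1) < re (f x) ∧
      r ≤ ‖x - x₀‖ := by
    intro n
    by_contra! hn
    exact hf ⟨1 / ((n : ℝ) + 1), by positivity, x₀, fun x hx hfx => hn x hx hfx⟩
  choose u hu hfu hru using hbad
  have hlim : Tendsto (fun n : ℕ => ‖f‖ - 1 / ((n : ℝ) + 1)) atTop (𝓝 ‖f‖) := by
    simpa using tendsto_const_nhds.sub (tendsto_one_div_add_atTop_nhds_zero_nat (𝕜 := ℝ))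
  have hu₀ := h.2.2 u hu <| tendsto_of_tendsto_of_tendsto_of_le_of_le hlim tendsto_const_nhds
    (fun n => (hfu n).le) fun n => (re_le_norm _).trans (f.unit_le_opNorm _ (hu n))
  have hle := ge_of_tendsto' (tendsto_iff_norm_sub_tendsto_zero.1 hu₀) hru
  linarith

lemma exists_unitBall_lt_norm {Y : Type} [NormedAddCommGroup Y] [NormedSpace 𝕜 Y]
    (T : X →L[𝕜] Y) {δ : ℝ} (hδ : 0 < δ) : ∃ x : X, ‖x‖ ≤ 1 ∧ ‖T‖ - δ < ‖T x‖ := by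
  by_contra! h
  have h0 : 0 ≤ ‖T‖ - δ := (norm_nonneg _).trans (h 0 (by simp))
  have := ContinuousLinearMap.opNorm_le_of_unit_norm h0 fun x hx => h x hx.le
  linarith

lemma exists_unitBall_seq_tendsto_norm {Y : Type} [NormedAddCommGroup Y] [NormedSpace 𝕜 Y]
    (T : X →L[𝕜] Y) :
    ∃ u : ℕ → X, (∀ n, ‖u n‖ ≤ 1) ∧ Tendsto (fun n => ‖T (u n)‖) atTop (𝓝 ‖T‖) := by
  choose u hu hTu using fun n : ℕ =>
    exists_unitBall_lt_norm T (δ := 1 / ((n : ℝ) + 1)) (by positivity)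
  have hlim : Tendsto (fun n : ℕ => ‖T‖ - 1 / ((n : ℝ) + 1)) atTop (𝓝 ‖T‖) := by
    simpa using tendsto_const_nhds.sub (tendsto_one_div_add_atTop_nhds_zero_nat (𝕜 := ℝ))
  exact ⟨u, hu, tendsto_of_tendsto_of_tendsto_of_le_of_le hlim tendsto_const_nhds
    (fun n => (hTu n).le) fun n => T.unit_le_opNorm _ (hu n)⟩

/-- Every scalar can be rotated onto its modulus. -/
lemma exists_norm_one_mul_eq_norm (c : 𝕜) : ∃ θ : 𝕜, ‖θ‖ = 1 ∧ θ * c = (‖c‖ : 𝕜) := by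
  obtain rfl | hc := eq_or_ne c 0
  · exact ⟨1, by simp, by simp⟩
  · have hc' : (‖c‖ : 𝕜) ≠ 0 := by simpa using hc
    refine ⟨(‖c‖ : 𝕜) / c, by simp [hc], by field_simp⟩

lemma exists_stronglyExposesBall [CompleteSpace X] {f : X →L[𝕜] 𝕜}
    (hf : ∀ k : ℕ, f ∈ smallSliceFunctionals 𝕜 X (1 / ((k : ℝ) + 1))) :
    ∃ x₀, StronglyExposesBall f x₀ := by
  have hclose : ∀ ε : ℝ, 0 < ε → ∃ δ : ℝ, 0 < δ ∧ ∀ x y : X, ‖x‖ ≤ 1 → ‖y‖ ≤ 1 →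
      ‖f‖ - δ < re (f x) → ‖f‖ - δ < re (f y) → dist x y < ε := by
    intro ε hε
    obtain ⟨k, hk⟩ := exists_nat_one_div_lt (half_pos hε)
    obtain ⟨δ, hδ, z, hz⟩ := hf k
    refine ⟨δ, hδ, fun x y hx hy hfx hfy => ?_⟩
    have h1 := hz x hx hfx
    have h2 := hz y hy hfy
    rw [← dist_eq_norm] at h1 h2
    have := dist_triangle_right x y z
    linarith
  obtain ⟨v, hv, hfv⟩ := exists_unitBall_seq_tendsto_norm f
  choose θ hθ hθv using fun n => exists_norm_one_mul_eq_norm (f (v n))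
  set u : ℕ → X := fun n => θ n • v n with hu_def
  have hu : ∀ n, ‖u n‖ ≤ 1 := fun n => by simp [hu_def, norm_smul, hθ, hv]
  have hfu : Tendsto (fun n => re (f (u n))) atTop (𝓝 ‖f‖) := by
    simpa [hu_def, hθv] using hfv
  have hcauchy : CauchySeq u := by
    rw [Metric.cauchySeq_iff]
    intro ε hε
    obtain ⟨δ, hδ, h⟩ := hclose ε hε
    obtain ⟨N, hN⟩ := eventually_atTop.1 (hfu.eventually (lt_mem_nhds (sub_lt_self ‖f‖ hδ)))
    exact ⟨N, fun m hm n hn => h _ _ (hu m) (hu n) (hN m hm) (hN n hn)⟩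
  obtain ⟨x₀, hx₀⟩ := cauchySeq_tendsto_of_complete hcauchy
  have hx₀_norm : ‖x₀‖ ≤ 1 := le_of_tendsto' hx₀.norm hu
  have hfx₀ : re (f x₀) = ‖f‖ := tendsto_nhds_unique
    ((RCLike.continuous_re.comp f.continuous).tendsto x₀ |>.comp hx₀) hfu
  refine ⟨x₀, hx₀_norm, hfx₀, fun w hw hfw => ?_⟩
  rw [Metric.tendsto_nhds]
  intro ε hε
  obtain ⟨δ, hδ, h⟩ := hclose ε hε
  filter_upwards [hfw.eventually (lt_mem_nhds (sub_lt_self ‖f‖ hδ))] with n hn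
  exact h _ _ (hw n) hx₀_norm hn (by linarith)

lemma StronglyExposesBall.apply_eq_norm {f : X →L[𝕜] 𝕜} {x₀ : X}
    (h : StronglyExposesBall f x₀) : f x₀ = (‖f‖ : 𝕜) := by
  have hnorm : ‖f x₀‖ = ‖f‖ :=
    le_antisymm (f.unit_le_opNorm _ h.1) (h.2.1 ▸ re_le_norm _)
  rw [← hnorm]
  exact norm_le_re_iff_eq_norm.1 (h.2.1 ▸ hnorm.le)

lemma StronglyExposesBall.absStronglyExposes {f : X →L[𝕜] 𝕜} {x₀ : X}
    (h : StronglyExposesBall f x₀) : AbsStronglyExposes f x₀ := by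
  refine ⟨h.1, fun u hu hfu => ?_⟩
  choose θ hθ hθu using fun n => exists_norm_one_mul_eq_norm (f (u n))
  exact ⟨θ, hθ, h.2.2 _ (fun n => by simp [norm_smul, hθ, hu]) (by simpa [hθu] using hfu)⟩

end Functionals

section Operators

variable {𝕜 X Y : Type} [RCLike 𝕜] [NormedAddCommGroup X] [NormedSpace 𝕜 X]
  [NormedAddCommGroup Y] [NormedSpace 𝕜 Y]

lemma isCompactOperator_smulRight (f : X →L[𝕜] 𝕜) (y : Y) :
    IsCompactOperator (f.smulRight y) := by
  exact (isCompactOperator_of_locallyCompactSpace_rng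
    (ContinuousLinearMap.toSpanSingleton 𝕜 y)).comp_clm f

/-- The adjoint of a compact operator attains its norm on every James boundary. -/
lemma IsCompactOperator.exists_norm_comp_eq {ι : Type} {ystar : ι → (Y →L[𝕜] 𝕜)}
    (h1 : ∀ n, ‖ystar n‖ = 1) (h2 : ∀ y : Y, ∃ n, ‖ystar n y‖ = ‖y‖)
    {T : X →L[𝕜] Y} (hT : IsCompactOperator T) : ∃ n, ‖(ystar n).comp T‖ = ‖T‖ := by
  obtain ⟨u, hu, hTu⟩ := exists_unitBall_seq_tendsto_norm T
  have hK : IsCompact (closure (T '' Metric.closedBall 0 1)) :=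
    hT.isCompact_closure_image_closedBall 1
  obtain ⟨y, -, φ, hφ, hy⟩ := hK.tendsto_subseq (x := fun n => T (u n)) fun n =>
    subset_closure ⟨u n, by simpa using hu n, rfl⟩
  have hy_norm : ‖y‖ = ‖T‖ := tendsto_nhds_unique hy.norm (hTu.comp hφ.tendsto_atTop)
  obtain ⟨n, hn⟩ := h2 y
  refine ⟨n, le_antisymm ?_ ?_⟩
  · simpa [h1] using (ystar n).opNorm_comp_le T
  · rw [← hy_norm, ← hn]
    exact le_of_tendsto' (((ystar n).continuous.tendsto y).comp hy).norm fun k =>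
      ((ystar n).comp T).unit_le_opNorm _ (hu (φ k))

/-- An operator attaining its norm at a strongly exposed point of the ball is absolutely strongly
exposing after adding a suitable rank-one operator. -/
lemma StronglyExposesBall.absStronglyExposes_add_smulRight {f : X →L[𝕜] 𝕜} {x₀ : X}
    (hf : StronglyExposesBall f x₀) {T : X →L[𝕜] Y} (hT : T ≠ 0) (hTx₀ : ‖T x₀‖ = ‖T‖)
    {δ : ℝ} (hδ : 0 < δ) :
    AbsStronglyExposes (T + f.smulRight ((δ : 𝕜) • T x₀)) x₀ := by
  set S := T + f.smulRight ((δ : 𝕜) • T x₀) with hS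
  have hT_pos : 0 < ‖T‖ := norm_pos_iff.2 hT
  have hle : ∀ x : X, ‖x‖ ≤ 1 → ‖S x‖ ≤ ‖T‖ + δ * ‖T‖ * ‖f x‖ := by
    intro x hx
    calc ‖S x‖ = ‖T x + f x • (δ : 𝕜) • T x₀‖ := by simp [hS]
      _ ≤ ‖T x‖ + ‖f x • (δ : 𝕜) • T x₀‖ := norm_add_le _ _
      _ = ‖T x‖ + δ * ‖T‖ * ‖f x‖ := by
        simp only [norm_smul, norm_ofReal, abs_of_pos hδ, hTx₀]; ring
      _ ≤ _ := by gcongr; exact T.unit_le_opNorm x hx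
  have hSx₀ : ‖S x₀‖ = ‖T‖ + δ * ‖T‖ * ‖f‖ := by
    have hx : S x₀ = ((1 + ‖f‖ * δ : ℝ) : 𝕜) • T x₀ := by
      simp [hS, hf.apply_eq_norm, add_smul, mul_smul]
    rw [hx, norm_smul, norm_ofReal, abs_of_pos (by positivity), hTx₀]; ring
  have hS_norm : ‖T‖ + δ * ‖T‖ * ‖f‖ ≤ ‖S‖ := hSx₀ ▸ S.unit_le_opNorm x₀ hf.1
  refine ⟨hf.1, fun u hu hSu => hf.absStronglyExposes.2 u hu ?_⟩
  have hpos : 0 < δ * ‖T‖ := by positivity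
  have hlim : Tendsto (fun n => (‖S (u n)‖ - ‖T‖ + (‖T‖ + δ * ‖T‖ * ‖f‖ - ‖S‖)) / (δ * ‖T‖))
      atTop (𝓝 ‖f‖) := by
    convert ((hSu.sub_const ‖T‖).add_const (‖T‖ + δ * ‖T‖ * ‖f‖ - ‖S‖)).div_const (δ * ‖T‖)
      using 2
    field_simp
    ring
  refine tendsto_of_tendsto_of_tendsto_of_le_of_le hlim tendsto_const_nhds (fun n => ?_)
    fun n => f.unit_le_opNorm _ (hu n)
  rw [div_le_iff₀ hpos]
  have := hle (u n) (hu n)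
  linarith

/-- Composition with a nonzero functional is an open map from a Banach space of operators containing
the rank-one operators to the dual. -/
lemma isOpenMap_comp_coe {K : Submodule 𝕜 (X →L[𝕜] Y)} [CompleteSpace K]
    (hK : ∀ (f : X →L[𝕜] 𝕜) (y : Y), f.smulRight y ∈ K) {g : Y →L[𝕜] 𝕜} (hg : g ≠ 0) :
    IsOpenMap fun T : K => g.comp (T : X →L[𝕜] Y) := by
  let L : K →L[𝕜] (X →L[𝕜] 𝕜) :=
    (ContinuousLinearMap.compL 𝕜 X Y 𝕜 g).comp (Submodule.subtypeL K)
  obtain ⟨y, hy⟩ : ∃ y, g y ≠ 0 := by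
    by_contra! h
    exact hg (ContinuousLinearMap.ext h)
  have hL : Function.Surjective L := by
    refine fun f => ⟨⟨f.smulRight ((g y)⁻¹ • y), hK _ _⟩, ?_⟩
    ext x
    simp [L, hy]
  exact ContinuousLinearMap.isOpenMap (𝕜 := 𝕜) (𝕜' := 𝕜) (E := K) (F := X →L[𝕜] 𝕜)
    (σ := RingHom.id 𝕜) L hL

lemma exists_mem_forall_stronglyExposesBall_comp [CompleteSpace X]
    (hSE : Dense {f : X →L[𝕜] 𝕜 | ∃ x₀, StronglyExposesBall f x₀})
    {ι : Type} [Countable ι] {ystar : ι → (Y →L[𝕜] 𝕜)} (hne : ∀ n, ystar n ≠ 0)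
    {K : Submodule 𝕜 (X →L[𝕜] Y)} (hK_complete : IsComplete (K : Set (X →L[𝕜] Y)))
    (hK : ∀ (f : X →L[𝕜] 𝕜) (y : Y), f.smulRight y ∈ K)
    {T : X →L[𝕜] Y} (hT : T ∈ K) {ε : ℝ} (hε : 0 < ε) :
    ∃ R ∈ K, ‖R - T‖ < ε ∧ ∀ n, ∃ x₀, StronglyExposesBall ((ystar n).comp R) x₀ := by
  have : CompleteSpace K := hK_complete.completeSpace_coe
  have hcont : ∀ n, Continuous fun R : K => (ystar n).comp (R : X →L[𝕜] Y) := fun n =>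
    ((ContinuousLinearMap.compL 𝕜 X Y 𝕜 (ystar n)).comp (Submodule.subtypeL K)).continuous
  have hdense := dense_iInter_of_isOpen
    (f := fun p : ι × ℕ => (fun R : K => (ystar p.1).comp (R : X →L[𝕜] Y)) ⁻¹'
      smallSliceFunctionals 𝕜 X (1 / ((p.2 : ℝ) + 1)))
    (fun p => (isOpen_smallSliceFunctionals _).preimage (hcont p.1))
    (fun p => (hSE.mono fun f hf => hf.choose_spec.mem_smallSliceFunctionals
      (by positivity)).preimage (isOpenMap_comp_coe hK (hne p.1)))
  obtain ⟨R, hR, hRT⟩ := hdense.exists_dist_lt ⟨T, hT⟩ hε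
  refine ⟨R, R.2, ?_, fun n => exists_stronglyExposesBall fun k => Set.mem_iInter.1 hR (n, k)⟩
  rwa [dist_comm, Subtype.dist_eq, dist_eq_norm] at hRT

end Operators

theorem stmt13 {𝕜 X Y : Type} [RCLike 𝕜]
    [NormedAddCommGroup X] [NormedSpace 𝕜 X] [CompleteSpace X]
    [NormedAddCommGroup Y] [NormedSpace 𝕜 Y] [CompleteSpace Y]
    (hSE : Dense {f : X →L[𝕜] 𝕜 | ∃ x₀, StronglyExposesBall f x₀})
    (ystar : ℕ → (Y →L[𝕜] 𝕜)) (h1 : ∀ n, ‖ystar n‖ = 1)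
    (h2 : ∀ y : Y, ∃ n, ‖ystar n y‖ = ‖y‖) :
    ∀ T : X →L[𝕜] Y, IsCompactOperator T → ∀ ε : ℝ, 0 < ε →
      ∃ S : X →L[𝕜] Y, IsCompactOperator S ∧
        (∃ x₀, AbsStronglyExposes S x₀) ∧ ‖S - T‖ < ε := by
  intro T hT ε hε
  have hne : ∀ n, ystar n ≠ 0 := fun n h => by simpa [h] using h1 n
  obtain ⟨R, hR_compact, hRT, hR⟩ := exists_mem_forall_stronglyExposesBall_comp hSE hne
    (K := compactOperator (RingHom.id 𝕜) X Y) isClosed_setOfPred_isCompactOperator.isComplete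
    isCompactOperator_smulRight hT (half_pos hε)
  replace hR_compact : IsCompactOperator R := hR_compact
  obtain ⟨n, hn⟩ := IsCompactOperator.exists_norm_comp_eq h1 h2 hR_compact
  obtain ⟨x₀, hx₀⟩ := hR n
  obtain rfl | hR0 := eq_or_ne R 0
  · refine ⟨0, hR_compact, ⟨x₀, hx₀.1, fun u hu _ => ⟨1, by simp, ?_⟩⟩, by linarith⟩
    simpa using hx₀.2.2 u hu (by simp)
  have hRx₀ : ‖R x₀‖ = ‖R‖ := by
    refine le_antisymm (R.unit_le_opNorm _ hx₀.1) ?_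
    calc ‖R‖ = re (((ystar n).comp R) x₀) := by rw [hx₀.2.1, hn]
      _ ≤ ‖ystar n (R x₀)‖ := re_le_norm _
      _ ≤ ‖R x₀‖ := by simpa [h1] using (ystar n).le_opNorm (R x₀)
  have hR_pos : 0 < ‖R‖ := norm_pos_iff.2 hR0
  set δ := ε / 2 / (‖R‖ * ‖R‖) with hδ_def
  have hδ : 0 < δ := by positivity
  refine ⟨R + ((ystar n).comp R).smulRight ((δ : 𝕜) • R x₀),
    hR_compact.add (isCompactOperator_smulRight _ _),
    ⟨x₀, hx₀.absStronglyExposes_add_smulRight hR0 hRx₀ hδ⟩, ?_⟩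
  have hrank : ‖((ystar n).comp R).smulRight ((δ : 𝕜) • R x₀)‖ = ε / 2 := by
    rw [ContinuousLinearMap.norm_smulRight_apply, hn, norm_smul, norm_ofReal, abs_of_pos hδ,
      hRx₀, hδ_def]
    field_simp
  calc _ = ‖(R - T) + ((ystar n).comp R).smulRight ((δ : 𝕜) • R x₀)‖ := by
        rw [add_sub_right_comm]
    _ ≤ ‖R - T‖ + _ := norm_add_le _ _
    _ < ε := by rw [hrank]; linarith
end
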